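/- arXiv:2405.09947 — 2 statements merged into one kernel-verified Lean document; each statement's English description precedes it below -/
import Mathlib

section
/- Let k be a field, V a finite-dimensional k-vector space, n ≥ 0 an integer, and A_1, …, A_m pairwise commuting nilpotent k-linear endomorphisms of V. Then the following are equivalent: (i) for all nonnegative integers k_1, …, k_m with k_1 + ⋯ + k_m = n+1 one has A_1^{k_1} ∘ ⋯ ∘ A_m^{k_m} = 0; (ii) there exists a chain of subspaces 0 = V_0 ⊆ V_1 ⊆ ⋯ ⊆ V_{n+1} = V such that A_i(V_j) ⊆ V_{j−1} for all 1 ≤ i ≤ m and all 1 ≤ j ≤ n+1. -/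
/-- Raising one exponent by one in an ordered monomial in commuting elements multiplies the
monomial by the corresponding element. -/
theorem List.prod_ofFn_pow_add_single {M : Type*} [Monoid M] {m : ℕ} (a : Fin m → M)
    (hcomm : ∀ i j, Commute (a i) (a j)) (κ : Fin m → ℕ) (i : Fin m) :
    (List.ofFn fun j => a j ^ (κ + Pi.single i 1 : Fin m → ℕ) j).prod =
      a i * (List.ofFn fun j => a j ^ κ j).prod := by
  induction m with
  | zero => exact i.elim0
  | succ m ih =>
    simp only [List.ofFn_succ, List.prod_cons]
    cases i using Fin.cases with
    | zero => simp [pow_succ', mul_assoc]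
    | succ i =>
      have h := ih (fun j => a j.succ) (fun _ _ => hcomm _ _) (fun j => κ j.succ) i
      have hs : ∀ j : Fin m, (κ + Pi.single i.succ 1 : Fin (m + 1) → ℕ) j.succ =
          ((fun j => κ j.succ) + Pi.single i 1 : Fin m → ℕ) j := fun j => by
        simp [Pi.single_apply]
      simp only [hs, h]
      simp only [Pi.add_apply, Pi.single_eq_of_ne (Fin.succ_ne_zero i).symm, add_zero,
        ← mul_assoc, ((hcomm 0 i.succ).pow_left (κ 0)).eq]

/-- An element commuting with all factors commutes with an ordered monomial in them. -/
theorem Commute.prod_ofFn_pow {M : Type*} [Monoid M] {m : ℕ} {a : Fin m → M} {b : M}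
    (h : ∀ j, Commute b (a j)) (κ : Fin m → ℕ) :
    Commute b (List.ofFn fun j => a j ^ κ j).prod := by
  refine Commute.list_prod_right _ _ fun x hx => ?_
  obtain ⟨j, rfl⟩ := (List.mem_ofFn' _ _).1 hx
  exact (h j).pow_right _

/-- A tuple of natural numbers with sum `s + 1` arises from one with sum `s` by raising one
entry by one. -/
theorem exists_eq_add_single_of_sum_eq_succ {ι : Type*} [Fintype ι] [DecidableEq ι]
    {κ : ι → ℕ} {s : ℕ} (h : ∑ i, κ i = s + 1) :
    ∃ (μ : ι → ℕ) (i : ι), κ = μ + Pi.single i 1 ∧ ∑ i, μ i = s := by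
  obtain ⟨i, -, hi⟩ := Finset.exists_ne_zero_of_sum_ne_zero (h.trans_ne s.succ_ne_zero)
  have hκ : κ = (κ - Pi.single i 1) + Pi.single i 1 := by
    ext j
    by_cases hj : j = i
    · subst hj
      simp
      omega
    · simp [hj]
  refine ⟨κ - Pi.single i 1, i, hκ, ?_⟩
  rw [hκ] at h
  simpa [Finset.sum_add_distrib] using h


/-- **Lemma 2.7.** Let `k` be a field, `V` a finite-dimensional `k`-vector space, `n ≥ 0` and
`A 1, …, A m` pairwise commuting nilpotent endomorphisms of `V`.  Then all products
`A 1 ^ k 1 ∘ ⋯ ∘ A m ^ k m` with `k 1 + ⋯ + k m = n + 1` vanish if and only if there is a chain of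
subspaces `0 = V 0 ⊆ V 1 ⊆ ⋯ ⊆ V (n+1) = V` with `A i (V j) ⊆ V (j-1)` for all `i` and all
`1 ≤ j ≤ n+1`. -/
theorem commuting_nilpotent_monomials_vanish_iff_flag
    {k V : Type*} [Field k] [AddCommGroup V] [Module k V] [FiniteDimensional k V]
    (n m : ℕ) (A : Fin m → Module.End k V)
    (hcomm : ∀ i j, Commute (A i) (A j))
    (hnil : ∀ i, IsNilpotent (A i)) :
    (∀ κ : Fin m → ℕ, (∑ i, κ i) = n + 1 →
        (List.ofFn fun i => A i ^ κ i).prod = 0) ↔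
      (∃ W : ℕ → Submodule k V, W 0 = ⊥ ∧ W (n + 1) = ⊤ ∧
        (∀ j, j ≤ n → W j ≤ W (j + 1)) ∧
        (∀ i, ∀ j, j ≤ n → Submodule.map (A i) (W (j + 1)) ≤ W j)) := by
  constructor
  · intro h
    refine ⟨fun j => ⨅ (κ : Fin m → ℕ) (_ : ∑ i, κ i = j),
      LinearMap.ker (List.ofFn fun i => A i ^ κ i).prod, ?_, ?_, fun j _ => ?_, fun i j _ => ?_⟩
    · rw [eq_bot_iff]
      refine (iInf₂_le (0 : Fin m → ℕ) (by simp)).trans fun x hx => ?_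
      simpa using hx
    · simp only [iInf_eq_top]
      intro κ hκ
      rw [h κ hκ, LinearMap.ker_zero]
    · refine le_iInf₂ fun κ hκ => ?_
      obtain ⟨μ, i, rfl, hμ⟩ := exists_eq_add_single_of_sum_eq_succ hκ
      refine (iInf₂_le μ hμ).trans ?_
      rw [List.prod_ofFn_pow_add_single A hcomm]
      exact LinearMap.ker_le_ker_comp _ _
    · refine le_iInf₂ fun κ hκ => ?_
      rw [Submodule.map_le_iff_le_comap]
      refine (iInf₂_le (κ + Pi.single i 1) (by simp [Finset.sum_add_distrib, hκ])).trans ?_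
      rw [List.prod_ofFn_pow_add_single A hcomm, (Commute.prod_ofFn_pow (hcomm i) κ).eq]
      exact (LinearMap.ker_comp _ _).le
  · rintro ⟨W, h0, htop, -, hW⟩
    have key : ∀ (s j : ℕ) (κ : Fin m → ℕ), ∑ i, κ i = s → j + s = n + 1 →
        ∀ x, (List.ofFn fun i => A i ^ κ i).prod x ∈ W j := by
      intro s
      induction s with
      | zero =>
        rintro j κ - rfl x
        simp [htop]
      | succ s ih =>
        intro j κ hκ hj x
        obtain ⟨μ, i, rfl, hμ⟩ := exists_eq_add_single_of_sum_eq_succ hκ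
        rw [List.prod_ofFn_pow_add_single A hcomm]
        exact hW i j (by omega) (Submodule.mem_map_of_mem (ih (j + 1) μ hμ (by omega) x))
    intro κ hκ
    ext x
    simpa [h0] using key (n + 1) 0 κ hκ (zero_add _) x
end

section
/- Let p be a prime, R a commutative ring in which p·1_R = 0, δ : R → R a derivation, and r ≥ 1. For A ∈ Mat_r(R) let δA denote the matrix obtained by applying δ to each entry of A. Suppose A·(δA) = (δA)·A, A^p = 0, and A^{p−1}·(δA) = 0. Then E(−A) · δ(E(A)) = δA, where δ(E(A)) is obtained by applying δ entrywise to the truncated exponential E(A). -/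
/-- The truncated exponential `E(A) = ∑_{m=0}^{p-1} (1/m!) • A^m` of a square matrix over a
commutative ring in which `p • 1 = 0`; here `1/m!` is the inverse of the image of `m!`,
realized as the image in `R` of the inverse of `m!` in `ℤ/p`. -/
def truncExp (p : ℕ) {R : Type*} [CommRing R] {r : ℕ}
    (A : Matrix (Fin r) (Fin r) R) : Matrix (Fin r) (Fin r) R :=
  ∑ m ∈ Finset.range p, ((((Nat.factorial m : ZMod p)⁻¹).val : R)) • A ^ m

/-- In a ring with `p = 0`, the scalar `1/m!` used by `truncExp` is inverse to `m!` for `m < p`. -/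
lemma cast_val_inv_factorial_mul {R : Type*} [CommRing R] {p : ℕ} (hp : p.Prime)
    (hpR : (p : R) = 0) {m : ℕ} (hm : m < p) :
    ((((Nat.factorial m : ZMod p)⁻¹).val : R)) * (Nat.factorial m : R) = 1 := by
  have : Fact p.Prime := ⟨hp⟩
  have hne : (Nat.factorial m : ZMod p) ≠ 0 := by
    rw [Ne, ZMod.natCast_eq_zero_iff, hp.dvd_factorial]
    exact not_le.mpr hm
  have hmod : ((Nat.factorial m : ZMod p)⁻¹).val * Nat.factorial m ≡ 1 [MOD p] := by
    rw [← ZMod.natCast_eq_natCast_iff]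
    simp [hne]
  obtain ⟨k, hk⟩ := hmod.symm.dvd
  have hR := congrArg (Int.cast : ℤ → R) hk
  push_cast at hR
  rw [hpR, zero_mul] at hR
  exact sub_eq_zero.mp hR

/-- Orthogonality of inverse factorials: if `c m` is inverse to `m!` for all `m < p`, then the
coefficients of `E(-X) * E(X)` in degrees `d < p` are those of `1`. -/
lemma sum_antidiagonal_neg_one_pow_mul_inv_factorial {R : Type*} [CommRing R] {p : ℕ} {c : ℕ → R}
    (hc : ∀ m < p, c m * (Nat.factorial m : R) = 1) {d : ℕ} (hd : d < p) :
    ∑ x ∈ Finset.HasAntidiagonal.antidiagonal d, (-1) ^ x.1 * c x.1 * c x.2 =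
      if d = 0 then 1 else 0 := by
  have key : ∑ x ∈ Finset.HasAntidiagonal.antidiagonal d, (-1) ^ x.1 * c x.1 * c x.2
      = c d * ((-1 : R) + 1) ^ d := by
    rw [(Commute.all (-1 : R) 1).add_pow', Finset.mul_sum]
    refine Finset.sum_congr rfl fun x hx => ?_
    obtain ⟨i, j⟩ := x
    rw [Finset.HasAntidiagonal.mem_antidiagonal] at hx
    dsimp only at hx ⊢
    subst hx
    have hi := hc i (by omega)
    have hj := hc j (by omega)
    have hij := hc (i + j) hd
    have hch : ((i + j).choose i : R) * i.factorial * j.factorial = (i + j).factorial := by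
      rw [Nat.choose_symm_add]
      exact_mod_cast congrArg (Nat.cast : ℕ → R) (Nat.add_choose_mul_factorial_mul_factorial i j)
    rw [nsmul_eq_mul, one_pow, mul_one]
    have hcoef : c i * c j = c (i + j) * ((i + j).choose i : R) := by
      calc c i * c j = c i * c j * (c (i + j) * ((i + j).factorial : R)) := by rw [hij, mul_one]
        _ = c (i + j) * ((i + j).choose i : R) * (c i * i.factorial) * (c j * j.factorial) := by
            rw [← hch]; ring
        _ = c (i + j) * ((i + j).choose i : R) := by rw [hi, hj, mul_one, mul_one]
    rw [mul_assoc, hcoef]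
    ring
  rw [key, neg_add_cancel, zero_pow_eq]
  split_ifs with h
  · subst h
    simpa using hc 0 hd
  · exact mul_zero _

open Polynomial in
/-- `E(-A) * E(A) = 1` when `A ^ p = 0`. -/
lemma truncExp_neg_mul_truncExp {R : Type*} [CommRing R] {p r : ℕ} (hp : p.Prime)
    (hpR : (p : R) = 0) (A : Matrix (Fin r) (Fin r) R) (hAp : A ^ p = 0) :
    truncExp p (-A) * truncExp p A = 1 := by
  set c : ℕ → R := fun m => (((Nat.factorial m : ZMod p)⁻¹).val : R) with hc_def
  have hc : ∀ m < p, c m * (Nat.factorial m : R) = 1 := fun m hm =>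
    cast_val_inv_factorial_mul hp hpR hm
  let P : R[X] := ∑ m ∈ Finset.range p, C (c m) * X ^ m
  let Q : R[X] := ∑ m ∈ Finset.range p, C ((-1) ^ m * c m) * X ^ m
  have hP : aeval A P = truncExp p A := by
    simp [P, truncExp, hc_def, Algebra.smul_def]
  have hQ : aeval A Q = truncExp p (-A) := by
    simp only [Q, truncExp, map_sum, map_mul, map_pow, aeval_C, aeval_X]
    refine Finset.sum_congr rfl fun m _ => ?_
    rw [neg_pow A, Algebra.smul_def, map_neg, map_one, ← mul_assoc,
      ← (Algebra.commutes (c m) ((-1 : Matrix (Fin r) (Fin r) R) ^ m))]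
  have hdvd : (X : R[X]) ^ p ∣ Q * P - 1 := by
    rw [X_pow_dvd_iff]
    intro d hd
    rw [coeff_sub, coeff_mul, coeff_one, sub_eq_zero,
      ← sum_antidiagonal_neg_one_pow_mul_inv_factorial hc hd]
    refine Finset.sum_congr rfl fun x hx => ?_
    rw [Finset.HasAntidiagonal.mem_antidiagonal] at hx
    have h1 : x.1 < p := by omega
    have h2 : x.2 < p := by omega
    simp [P, Q, finsetSum_coeff, coeff_C_mul, coeff_X_pow, -map_mul, h1, h2]
  obtain ⟨S, hS⟩ := hdvd
  have h := congrArg (aeval A) hS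
  rw [map_sub, map_mul, map_mul, hP, hQ, map_one, map_pow, aeval_X, hAp, zero_mul] at h
  exact sub_eq_zero.mp h

/-- The Leibniz rule for a derivation applied entrywise to a product of matrices. -/
lemma Matrix.map_derivation_mul {R : Type*} [CommRing R] {n : Type*} [Fintype n]
    (δ : Derivation ℤ R R) (A B : Matrix n n R) :
    (A * B).map δ = A * B.map δ + A.map δ * B := by
  ext i j
  simp only [Matrix.map_apply, Matrix.mul_apply, Matrix.add_apply, map_sum, Derivation.leibniz,
    smul_eq_mul, Finset.sum_add_distrib]
  simp only [mul_comm]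

/-- The power rule for a matrix commuting with its entrywise derivative. -/
lemma Matrix.map_derivation_pow_succ {R : Type*} [CommRing R] {n : Type*} [Fintype n]
    [DecidableEq n] (δ : Derivation ℤ R R) (A : Matrix n n R)
    (h : A * A.map δ = A.map δ * A) (m : ℕ) :
    (A ^ (m + 1)).map δ = ((m + 1 : ℕ) : R) • (A ^ m * A.map δ) := by
  induction m with
  | zero => simp
  | succ m ih =>
    rw [pow_succ A (m + 1), Matrix.map_derivation_mul, ih, Matrix.smul_mul, mul_assoc, ← h,
      ← mul_assoc, ← pow_succ, Nat.cast_succ (m + 1), add_smul, one_smul, add_comm]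

/-- `δ(E(A)) = E(A) * δA` when `A` commutes with `δA` and `A ^ (p - 1) * δA = 0`. -/
lemma truncExp_map_derivation {R : Type*} [CommRing R] {p r : ℕ} (hp : p.Prime)
    (hpR : (p : R) = 0) (δ : Derivation ℤ R R) (A : Matrix (Fin r) (Fin r) R)
    (hAδ : A * A.map δ = A.map δ * A) (hAδ' : A ^ (p - 1) * A.map δ = 0) :
    (truncExp p A).map δ = truncExp p A * A.map δ := by
  have hc : ∀ m < p, _ := fun m hm => cast_val_inv_factorial_mul (R := R) hp hpR hm
  obtain ⟨q, rfl⟩ : ∃ q, p = q + 1 := ⟨p - 1, (Nat.sub_add_cancel hp.one_le).symm⟩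
  rw [Nat.add_sub_cancel] at hAδ'
  have hsmul : ∀ (k : ℕ) (B : Matrix (Fin r) (Fin r) R),
      ((k : R) • B).map δ = (k : R) • B.map δ := by
    intro k B
    ext i j
    simp
  have hsum : (truncExp (q + 1) A).map δ = ∑ m ∈ Finset.range (q + 1),
      ((((Nat.factorial m : ZMod (q + 1))⁻¹).val : R)) • (A ^ m).map δ := by
    simp only [← hsmul]
    ext i j
    simp only [truncExp, Matrix.map_apply, Matrix.sum_apply, map_sum]
  have hone : (1 : Matrix (Fin r) (Fin r) R).map δ = 0 := by
    ext i j
    by_cases hij : i = j <;> simp [hij]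
  rw [hsum, Finset.sum_range_succ', pow_zero, hone, smul_zero, add_zero, truncExp,
    Finset.sum_mul, Finset.sum_range_succ, Matrix.smul_mul, hAδ', smul_zero, add_zero]
  refine Finset.sum_congr rfl fun m hm => ?_
  rw [Finset.mem_range] at hm
  rw [Matrix.map_derivation_pow_succ δ A hAδ, smul_smul, Matrix.smul_mul]
  congr 1
  have h1 := hc m (by omega)
  have h2 := hc (m + 1) (by omega)
  generalize (((Nat.factorial m : ZMod (q + 1))⁻¹).val : R) = a at *
  generalize (((Nat.factorial (m + 1) : ZMod (q + 1))⁻¹).val : R) = b at *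
  rw [Nat.factorial_succ, Nat.cast_mul] at h2
  linear_combination a * h2 - b * ((m + 1 : ℕ) : R) * h1

/-- The key computational identity (∗) of Section 3.1: if `δ` is a derivation of `R`,
`A` commutes with its entrywise derivative `δA`, `A^p = 0` and `A^{p-1} * δA = 0`, then
`E(A)⁻¹ * δ(E(A)) = E(-A) * δ(E(A)) = δA`, where `δ` is applied entrywise. -/
theorem truncExp_neg_mul_deriv_truncExp {R : Type*} [CommRing R] (p r : ℕ)
    (hp : p.Prime) (hpR : (p : R) = 0) (hr : 1 ≤ r)
    (δ : Derivation ℤ R R) (A : Matrix (Fin r) (Fin r) R)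
    (hAδ : A * A.map δ = A.map δ * A)
    (hAp : A ^ p = 0)
    (hAδ' : A ^ (p - 1) * A.map δ = 0) :
    truncExp p (-A) * (truncExp p A).map δ = A.map δ := by
  rw [truncExp_map_derivation hp hpR δ A hAδ hAδ', ← mul_assoc,
    truncExp_neg_mul_truncExp hp hpR A hAp, one_mul]
end
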